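/- Fix positive integers m, r with n = m + r. Let ν ⊆ R_r, let δ = diag_0(ν^{∨_r}), fix an integer d with 0 ≤ d ≤ δ, set t = diag_0((ν⊕d)^{∨_r}), and let ρ = φ^r(ν) (so that (t^t) ⊆ ρ, since diag_0(ρ) = δ ≥ t). Writing ν ⊕ d = (η_t^1, η_t^2), one has η_t^1 = ρ^{L^t} + ((r−t)^{m−t}) (coordinate-wise addition) and η_t^2 = ρ^{R^t}. -/

import Mathlib

/-- The cells of the skew shape `lam/μ` (French notation, rows indexed from 1). -/
def skewCells (μ lam : ℕ → ℕ) : Set (ℕ × ℕ) :=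
  {c | 1 ≤ c.1 ∧ μ c.1 < c.2 ∧ c.2 ≤ lam c.1}

/-- Two cells share a full edge. -/
def AdjCell (a b : ℕ × ℕ) : Prop :=
  (a.1 = b.1 ∧ (a.2 + 1 = b.2 ∨ b.2 + 1 = a.2)) ∨
  (a.2 = b.2 ∧ (a.1 + 1 = b.1 ∨ b.1 + 1 = a.1))

/-- A set of cells is connected via shared edges. -/
def ConnectedCells (S : Set (ℕ × ℕ)) : Prop :=
  ∀ x ∈ S, ∀ y ∈ S,
    Relation.ReflTransGen (fun a b => a ∈ S ∧ b ∈ S ∧ AdjCell a b) x y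

/-- The set of cells contains no 2 × 2 square. -/
def No2x2 (S : Set (ℕ × ℕ)) : Prop :=
  ¬ ∃ i j, (i, j) ∈ S ∧ (i + 1, j) ∈ S ∧ (i, j + 1) ∈ S ∧ (i + 1, j + 1) ∈ S

/-- The head (southeasternmost cell) of the set of cells lies in column `r`. -/
def HeadInCol (S : Set (ℕ × ℕ)) (r : ℕ) : Prop :=
  ∃ i, (i, r) ∈ S ∧ ∀ c ∈ S, i ≤ c.1 ∧ c.2 ≤ r

/-- A partition, as a weakly decreasing, eventually zero function on rows `1, 2, …`. -/
def IsPartitionFun (lam : ℕ → ℕ) : Prop :=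
  (∀ i, 1 ≤ i → lam (i + 1) ≤ lam i) ∧ ∃ N, ∀ i, N ≤ i → lam i = 0

/-- `lam` is obtained from `μ` by adding one `n`-rim hook whose head lies in column `r`. -/
def AddRimHook (n r : ℕ) (μ lam : ℕ → ℕ) : Prop :=
  IsPartitionFun lam ∧ (∀ i, μ i ≤ lam i) ∧
  (skewCells μ lam).ncard = n ∧
  ConnectedCells (skewCells μ lam) ∧
  No2x2 (skewCells μ lam) ∧
  HeadInCol (skewCells μ lam) r

/-- `μ = ν ⊕ d`: `μ` is obtained from `ν` by successively adding `d` different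
`n`-rim hooks so that all `d` heads lie in column `r`. -/
def OplusChain (n r d : ℕ) (ν μ : ℕ → ℕ) : Prop :=
  ∃ f : ℕ → ℕ → ℕ, f 0 = ν ∧ f d = μ ∧ ∀ i, i < d → AddRimHook n r (f i) (f (i + 1))

/-- The transpose of a partition whose parts are indexed `1, …, rows`:
`(transposeFn rows lam) i = #{p ∈ [1,rows] : lam p ≥ i}`. -/
def transposeFn (rows : ℕ) (lam : ℕ → ℕ) (i : ℕ) : ℕ :=
  ((Finset.Icc 1 rows).filter (fun p => i ≤ lam p)).card

/-- The complement of a partition inside the rectangle with `rows` rows and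
`cols` columns. -/
def complRect (rows cols : ℕ) (lam : ℕ → ℕ) : ℕ → ℕ :=
  fun i => if 1 ≤ i ∧ i ≤ rows then cols - lam (rows + 1 - i) else 0

/-- `diag_0(lam) = #{i : lam_i ≥ i}`, the number of diagonal cells `(i,i)` of `lam`
(counted for `i ≤ B`, where `B` is any sufficiently large bound). -/
def diag0 (B : ℕ) (lam : ℕ → ℕ) : ℕ :=
  ((Finset.Icc 1 B).filter (fun i => i ≤ lam i)).card

/-- Position `p ∈ [1,n]` of the bit string of the partition `lam ⊆ R_r = (r^m)` is a `0`
(a vertical step of the boundary path): this happens exactly when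
`p = lam_i + (m−i) + 1` for some row `i ∈ [1,m]`. -/
def ZeroAt (m : ℕ) (lam : ℕ → ℕ) (p : ℕ) : Prop :=
  ∃ i, 1 ≤ i ∧ i ≤ m ∧ p = lam i + (m - i) + 1

lemma mono_of_step (f : ℕ → ℕ) (h : ∀ i, 1 ≤ i → f (i + 1) ≤ f i) (i j : ℕ) (hi : 1 ≤ i)
    (hij : i ≤ j) : f j ≤ f i := by
  induction j, hij using Nat.le_induction with
  | base => exact le_rfl
  | succ k hk ih => exact (h k (by omega)).trans ih

/-- counting a downward closed predicate -/
lemma card_down (P : ℕ → Prop) [DecidablePred P] (N : ℕ)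
    (h : ∀ i j, 1 ≤ i → i ≤ j → j ≤ N → P j → P i) :
    ((Finset.Icc 1 N).filter P).card ≤ N ∧
    ∀ i, 1 ≤ i → i ≤ N → (P i ↔ i ≤ ((Finset.Icc 1 N).filter P).card) := by
  induction N with
  | zero => simp; omega
  | succ N ih =>
    obtain ⟨h1, h2⟩ := ih (fun i j a b c d => h i j a b (by omega) d)
    have hIcc : Finset.Icc 1 (N + 1) = insert (N + 1) (Finset.Icc 1 N) := by
      ext x; simp; omega
    have hnot : N + 1 ∉ (Finset.Icc 1 N).filter P := by simp
    by_cases hP : P (N + 1)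
    · have hall : (Finset.Icc 1 (N + 1)).filter P = Finset.Icc 1 (N + 1) := by
        apply Finset.filter_true_of_mem
        intro x hx
        rw [Finset.mem_Icc] at hx
        exact h x (N + 1) hx.1 hx.2 le_rfl hP
      rw [hall]
      simp only [Nat.card_Icc]
      refine ⟨by omega, fun i hi1 hi2 => ?_⟩
      have := h i (N + 1) hi1 hi2 le_rfl hP
      simp only [this, true_iff]; omega
    · rw [hIcc, Finset.filter_insert, if_neg hP]
      refine ⟨by omega, fun i hi1 hi2 => ?_⟩
      by_cases hi : i = N + 1
      · subst hi
        simp only [hP, false_iff]; omega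
      · exact h2 i hi1 (by omega)

/-- Two strictly decreasing sequences on `[1,m]` with the same values agree. -/
lemma anti_unique (m : ℕ) (f g : ℕ → ℕ)
    (hf : ∀ i j, 1 ≤ i → i < j → j ≤ m → f j < f i)
    (hg : ∀ i j, 1 ≤ i → i < j → j ≤ m → g j < g i)
    (hfg : ∀ i, 1 ≤ i → i ≤ m → ∃ j, 1 ≤ j ∧ j ≤ m ∧ f i = g j)
    (hgf : ∀ i, 1 ≤ i → i ≤ m → ∃ j, 1 ≤ j ∧ j ≤ m ∧ g i = f j) :
    ∀ i, 1 ≤ i → i ≤ m → f i = g i := by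
  intro i
  induction i using Nat.strong_induction_on with
  | _ i ih =>
    intro h1 h2
    obtain ⟨j, j1, j2, hj⟩ := hfg i h1 h2
    obtain ⟨k, k1, k2, hk⟩ := hgf i h1 h2
    have hij : i ≤ j := by
      by_contra hc
      have a := ih j (by omega) j1 j2
      have b := hf j i j1 (by omega) h2
      omega
    have hik : i ≤ k := by
      by_contra hc
      have a := ih k (by omega) k1 k2
      have b := hg k i k1 (by omega) h2
      omega
    have a : g j ≤ g i := by
      rcases hij.eq_or_lt with h | h
      · rw [h]
      · exact (hg i j h1 h j2).le
    have b : f k ≤ f i := by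
      rcases hik.eq_or_lt with h | h
      · rw [h]
      · exact (hf i k h1 h k2).le
    omega

lemma sum_tele (μ lam : ℕ → ℕ) (r i0 e : ℕ) (hie : i0 ≤ e) (hle : ∀ i, μ i ≤ lam i)
    (h0 : lam i0 = r) (h : ∀ j, i0 ≤ j → j < e → lam (j + 1) = μ j + 1) :
    (∑ j ∈ Finset.Icc i0 e, (lam j - μ j)) + μ e + i0 = r + e := by
  induction e, hie using Nat.le_induction with
  | base => simp; have := hle i0; omega
  | succ k hk ih =>
    rw [Finset.sum_Icc_succ_top (by omega)]
    have a := ih (fun j a b => h j a (by omega))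
    have b := h k hk (by omega)
    have c := hle (k + 1)
    omega

lemma ncard_skew (μ lam : ℕ → ℕ) (i0 e : ℕ) (hi0 : 1 ≤ i0)
    (h : ∀ c ∈ skewCells μ lam, i0 ≤ c.1 ∧ c.1 ≤ e) :
    (skewCells μ lam).ncard = ∑ j ∈ Finset.Icc i0 e, (lam j - μ j) := by
  have hS : skewCells μ lam =
      ((((Finset.Icc i0 e).sigma (fun j => Finset.Ioc (μ j) (lam j))).map
        (Equiv.sigmaEquivProd ℕ ℕ).toEmbedding : Finset (ℕ × ℕ)) : Set (ℕ × ℕ)) := by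
    ext ⟨x, y⟩
    simp only [Finset.coe_map, Set.mem_image, Finset.mem_coe, Finset.mem_sigma, Finset.mem_Icc,
      Finset.mem_Ioc]
    constructor
    · intro hx
      exact ⟨⟨x, y⟩, ⟨h _ hx, hx.2⟩, rfl⟩
    · rintro ⟨⟨x', y'⟩, ⟨hx, hy⟩, heq⟩
      simp [Equiv.sigmaEquivProd] at heq
      obtain ⟨rfl, rfl⟩ := heq
      exact ⟨by simp at hx ⊢; omega, hy⟩
  rw [hS, Set.ncard_coe_finset, Finset.card_map, Finset.card_sigma]
  simp

lemma crossing (μ lam : ℕ → ℕ) (j : ℕ) (x y : ℕ × ℕ) (hx : x.1 ≤ j) (hy : j < y.1)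
    (h : Relation.ReflTransGen
      (fun a b => a ∈ skewCells μ lam ∧ b ∈ skewCells μ lam ∧ AdjCell a b) x y) :
    μ j + 1 ≤ lam (j + 1) := by
  by_contra hc
  have key : y.1 ≤ j := by
    clear hy
    induction h with
    | refl => exact hx
    | tail _ hstep ih =>
      rename_i b c _
      obtain ⟨⟨b1, b2, b3⟩, ⟨c1, c2, c3⟩, hadj⟩ := hstep
      by_contra hcon
      unfold AdjCell at hadj
      have e1 : b.1 = j := by omega
      have e2 : c.1 = j + 1 := by omega
      rw [e1] at b2
      rw [e2] at c3
      omega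
  omega

lemma rim (m r : ℕ) (μ lam : ℕ → ℕ) (hμ : ∀ i, 1 ≤ i → μ (i + 1) ≤ μ i)
    (h : AddRimHook (m + r) r μ lam) :
    ∃ i0 e, 1 ≤ i0 ∧ i0 ≤ e ∧ μ i0 < r ∧ lam i0 = r ∧
      (∀ j, 1 ≤ j → j < i0 → lam j = μ j ∧ r ≤ μ j) ∧
      (∀ j, i0 ≤ j → j < e → lam (j + 1) = μ j + 1) ∧
      (∀ j, e < j → lam j = μ j) ∧ μ e + m + i0 = e := by
  obtain ⟨⟨hlam, N, hN⟩, hle, hcard, hconn, h22, i0, hi0, hhead⟩ := h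
  obtain ⟨h1, h2, h3⟩ := hi0
  simp only at h1 h2 h3
  have hli0 : lam i0 = r := by
    have := (hhead (i0, lam i0) ⟨h1, by simp only; omega, le_rfl⟩).2
    simp only at this; omega
  have hrow : ∀ j, 1 ≤ j → μ j < lam j → i0 ≤ j := fun j a b => (hhead (j, lam j) ⟨a, b, le_rfl⟩).1
  have hi0N : i0 ≤ N := by
    by_contra hc
    have := hN i0 (by omega)
    omega
  set e := Nat.findGreatest (fun j => μ j < lam j) N with he
  have heP : μ e < lam e := Nat.findGreatest_spec (P := fun j => μ j < lam j) hi0N (by omega)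
  have hie : i0 ≤ e := Nat.le_findGreatest hi0N (by omega)
  have hgt : ∀ j, e < j → lam j = μ j := by
    intro j hj
    have := hle j
    by_contra hc
    by_cases hjN : j ≤ N
    · exact Nat.findGreatest_is_greatest hj hjN (by omega)
    · have := hN j (by omega); omega
  have hstep : ∀ j, i0 ≤ j → j < e → lam (j + 1) = μ j + 1 := by
    intro j a b
    have c := crossing μ lam j (i0, r) (e, lam e) a b
      (hconn _ ⟨h1, h2, h3⟩ _ ⟨by simp only; omega, heP, le_rfl⟩)
    by_contra hc
    have d1 := hlam j (by omega)
    have d2 := hμ j (by omega)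
    refine h22 ⟨j, μ j + 1, ?_, ?_, ?_, ?_⟩ <;> refine ⟨?_, ?_, ?_⟩ <;> simp only <;> omega
  refine ⟨i0, e, h1, hie, h2, hli0, ?_, hstep, hgt, ?_⟩
  · intro j a b
    have := hle j
    have heq : lam j = μ j := by
      by_contra hc
      have := hrow j a (by omega)
      omega
    have := mono_of_step lam hlam j i0 a b.le
    omega
  · have s := sum_tele μ lam r i0 e hie hle hli0 hstep
    rw [ncard_skew μ lam i0 e h1] at hcard
    · omega
    · rintro ⟨x, y⟩ hc
      refine ⟨(hhead _ hc).1, ?_⟩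
      by_contra hcon
      have := hgt x (by simpa using hcon)
      have h1 := hc.2.1
      have h2 := hc.2.2
      simp only at h1 h2
      omega

/-- The explicit form of `ν ⊕ (δ - t)`. -/
def Gfun (m r : ℕ) (ρ : ℕ → ℕ) (t i : ℕ) : ℕ :=
  if i ≤ m - t then min r (ρ (i + t) + (r - t)) else ρ (i - (m - t)) - t

lemma step (m r t : ℕ) (ρ μ lam : ℕ → ℕ) (htm : t + 1 ≤ m) (htr : t + 1 ≤ r)
    (hρmono : ∀ i, 1 ≤ i → ρ (i + 1) ≤ ρ i) (hρzero : ∀ i, m < i → ρ i = 0) (hρbd : ρ 1 ≤ r)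
    (hρt : t + 1 ≤ ρ (t + 1)) (hμ : ∀ i, 1 ≤ i → μ i = Gfun m r ρ (t + 1) i)
    (hμm : ∀ i, 1 ≤ i → μ (i + 1) ≤ μ i)
    (h : AddRimHook (m + r) r μ lam) : ∀ i, 1 ≤ i → lam i = Gfun m r ρ t i := by
  have hm := mono_of_step ρ hρmono
  obtain ⟨i0, e, h1, hie, h2, h3, h4, h5, h6, h7⟩ := rim m r μ lam hμm h
  have hi0 : i0 ≤ m - t := by
    by_contra hc
    have a := (h4 (m - t) (by omega) (by omega)).2
    rw [hμ _ (by omega), Gfun, if_neg (by omega)] at a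
    have b : m - t - (m - (t + 1)) = 1 := by omega
    rw [b] at a
    omega
  -- ρ (i0 + t + 1) < t + 1
  have hlow : ρ (i0 + t + 1) < t + 1 := by
    by_cases hc : i0 ≤ m - (t + 1)
    · rw [hμ _ h1, Gfun, if_pos hc, ← add_assoc] at h2
      omega
    · rw [hρzero _ (by omega)]; omega
  have hhigh : t + 1 ≤ ρ (i0 + t) := by
    by_cases hc : i0 = 1
    · subst hc; rwa [add_comm 1 t]
    · have a := (h4 (i0 - 1) (by omega) (by omega)).2
      rw [hμ _ (by omega), Gfun, if_pos (by omega)] at a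
      have b : i0 - 1 + (t + 1) = i0 + t := by omega
      rw [b] at a
      omega
  have hz : ∀ j, m + i0 ≤ j → μ j = 0 := by
    intro j hj
    rw [hμ _ (by omega), Gfun, if_neg (by omega)]
    have := hm (i0 + t + 1) (j - (m - (t + 1))) (by omega) (by omega)
    omega
  have he : e = m + i0 := by
    have := hz e (by omega)
    omega
  intro j hj
  unfold Gfun
  rcases lt_or_ge i0 j with hij | hij
  · rcases lt_or_ge e j with hej | hej
    · rw [h6 j hej, hz j (by omega), if_neg (by omega)]
      have := hm (i0 + t + 1) (j - (m - t)) (by omega) (by omega)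
      omega
    · have a := h5 (j - 1) (by omega) (by omega)
      rw [hμ _ (by omega), Gfun, Nat.sub_add_cancel hj] at a
      rw [a]
      by_cases hc : j ≤ m - t
      · rw [if_pos (by omega), if_pos hc]
        have b : j - 1 + (t + 1) = j + t := by omega
        rw [b]
        have := hm (i0 + t + 1) (j + t) (by omega) (by omega)
        omega
      · rw [if_neg (by omega), if_neg hc]
        have b : j - 1 - (m - (t + 1)) = j - (m - t) := by omega
        rw [b]
        have := hm (j - (m - t)) (i0 + t) (by omega) (by omega)
        omega
  · have hr : lam j = r := by
      rcases hij.eq_or_lt with h | h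
      · rw [h, h3]
      · have a := h4 j hj h
        rw [hμ _ hj, Gfun, if_pos (by omega)] at a
        omega
    rw [hr, if_pos (by omega)]
    have := hm (j + t) (i0 + t) (by omega) (by omega)
    omega

lemma diag_eq (m r t : ℕ) (ρ μ : ℕ → ℕ) (htm : t ≤ m) (htr : t ≤ r)
    (hρmono : ∀ i, 1 ≤ i → ρ (i + 1) ≤ ρ i) (hρbd : ρ 1 ≤ r)
    (hμ : ∀ i, 1 ≤ i → μ i = Gfun m r ρ t i) :
    diag0 (m + r) (complRect m r μ) = t := by
  have hm := mono_of_step ρ hρmono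
  have : (Finset.Icc 1 (m + r)).filter (fun i => i ≤ complRect m r μ i) = Finset.Icc 1 t := by
    ext s
    rw [Finset.mem_filter, Finset.mem_Icc, Finset.mem_Icc, complRect]
    by_cases hs : 1 ≤ s ∧ s ≤ m
    · rw [if_pos hs, hμ _ (by omega), Gfun]
      by_cases hc : s ≤ t
      · rw [if_neg (by omega)]
        have := hm 1 (m + 1 - s - (m - t)) (by omega) (by omega)
        omega
      · rw [if_pos (by omega)]
        omega
    · rw [if_neg hs]; omega
  rw [diag0, this]; simp

lemma base (m r : ℕ) (ν ρ : ℕ → ℕ)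
    (hνmono : ∀ i, 1 ≤ i → ν (i + 1) ≤ ν i)
    (hνzero : ∀ i, m < i → ν i = 0)
    (hνbd : ν 1 ≤ r)
    (hρmono : ∀ i, 1 ≤ i → ρ (i + 1) ≤ ρ i)
    (hρzero : ∀ i, m < i → ρ i = 0)
    (hρbd : ρ 1 ≤ r)
    (hcyc : ∀ p, 1 ≤ p → p ≤ m + r →
      (ZeroAt m ρ p ↔ ((p ≤ m ∧ ZeroAt m ν (p + r)) ∨ (m < p ∧ ZeroAt m ν (p - m)))))
    (δ : ℕ) (hδ : δ = diag0 (m + r) (complRect m r ν)) :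
    δ ≤ m ∧ δ ≤ r ∧ (1 ≤ δ → δ ≤ ρ δ) ∧ ∀ i, 1 ≤ i → ν i = Gfun m r ρ δ i := by
  have hn := mono_of_step ν hνmono
  have hm := mono_of_step ρ hρmono
  have cd := card_down (fun i => i ≤ complRect m r ν i) (m + r) (by
    intro i j hi hij hj hP
    simp only [complRect] at hP ⊢
    by_cases hc : 1 ≤ j ∧ j ≤ m
    · rw [if_pos hc] at hP
      rw [if_pos (by omega)]
      have := hn (m + 1 - j) (m + 1 - i) (by omega) (by omega)
      omega
    · rw [if_neg hc] at hP; omega)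
  change diag0 (m + r) (complRect m r ν) ≤ m + r ∧
    ∀ i, 1 ≤ i → i ≤ m + r → (i ≤ complRect m r ν i ↔ i ≤ diag0 (m + r) (complRect m r ν)) at cd
  rw [← hδ] at cd
  obtain ⟨c0, c1⟩ := cd
  have hmr : δ ≤ m ∧ δ ≤ r := by
    rcases Nat.eq_zero_or_pos δ with h | h
    · omega
    · have := (c1 δ h c0).2 le_rfl
      simp only [complRect] at this
      split_ifs at this <;> omega
  obtain ⟨hδm, hδr⟩ := hmr
  have small : ∀ i, m - δ < i → i ≤ m → ν i + (m - i) + 1 ≤ r := by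
    intro i a b
    have := (c1 (m + 1 - i) (by omega) (by omega)).2 (by omega)
    rw [complRect, if_pos (by omega)] at this
    have e : m + 1 - (m + 1 - i) = i := by omega
    rw [e] at this
    omega
  have big : ∀ i, 1 ≤ i → i ≤ m - δ → r < ν i + (m - i) + 1 := by
    intro i a b
    have := (c1 (m + 1 - i) (by omega) (by omega)).not.2 (by omega)
    rw [complRect, if_pos (by omega)] at this
    have e : m + 1 - (m + 1 - i) = i := by omega
    rw [e] at this
    omega
  have hνr : ∀ i, 1 ≤ i → ν i ≤ r := fun i hi => (hn 1 i le_rfl hi).trans hνbd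
  have hρr : ∀ i, 1 ≤ i → ρ i ≤ r := fun i hi => (hm 1 i le_rfl hi).trans hρbd
  have key : ∀ i, 1 ≤ i → i ≤ m → ρ i + (m - i) + 1 =
      if i ≤ δ then ν (m - δ + i) + (δ - i) + 1 + m else ν (i - δ) + (m - (i - δ)) + 1 - r := by
    apply anti_unique m (fun i => ρ i + (m - i) + 1) (fun i =>
      if i ≤ δ then ν (m - δ + i) + (δ - i) + 1 + m else ν (i - δ) + (m - (i - δ)) + 1 - r)
    · intro i j hi hij hj
      have := hm i j hi hij.le
      omega
    · intro i j hi hij hj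
      split_ifs with hA hB hB
      · have := hn (m - δ + i) (m - δ + j) (by omega) (by omega)
        omega
      · omega
      · have := hνr (j - δ) (by omega)
        omega
      · have := hn (i - δ) (j - δ) (by omega) (by omega)
        have := big (i - δ) (by omega) (by omega)
        have := big (j - δ) (by omega) (by omega)
        omega
    · intro i hi him
      have hb := hρr i hi
      rcases (hcyc (ρ i + (m - i) + 1) (by omega) (by omega)).1 ⟨i, hi, him, rfl⟩ with
        ⟨ha, k, k1, k2, hk⟩ | ⟨ha, k, k1, k2, hk⟩
      · have hkd : k ≤ m - δ := by
          by_contra hc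
          have := small k (by omega) k2
          omega
        refine ⟨k + δ, by omega, by omega, ?_⟩
        rw [if_neg (by omega), Nat.add_sub_cancel]
        omega
      · have hkd : m - δ < k := by
          by_contra hc
          have := big k (by omega) (by omega)
          omega
        refine ⟨k - (m - δ), by omega, by omega, ?_⟩
        have e : m - δ + (k - (m - δ)) = k := by omega
        rw [if_pos (by omega), e]
        omega
    · intro i hi him
      split_ifs with hA
      · have s := small (m - δ + i) (by omega) (by omega)
        obtain ⟨k, k1, k2, hk⟩ := (hcyc (ν (m - δ + i) + (δ - i) + 1 + m) (by omega) (by omega)).2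
          (Or.inr ⟨by omega, m - δ + i, by omega, by omega, by omega⟩)
        exact ⟨k, k1, k2, hk⟩
      · have s := big (i - δ) (by omega) (by omega)
        have s2 := hνr (i - δ) (by omega)
        obtain ⟨k, k1, k2, hk⟩ := (hcyc (ν (i - δ) + (m - (i - δ)) + 1 - r)
          (by omega) (by omega)).2
          (Or.inl ⟨by omega, i - δ, by omega, by omega, by omega⟩)
        exact ⟨k, k1, k2, hk⟩
  refine ⟨hδm, hδr, ?_, ?_⟩
  · intro h
    have := key δ h hδm
    rw [if_pos le_rfl] at this
    omega
  · intro i hi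
    unfold Gfun
    split_ifs with hA
    · have := key (i + δ) (by omega) (by omega)
      rw [if_neg (by omega), Nat.add_sub_cancel] at this
      have := big i hi hA
      have := hνr i hi
      omega
    · by_cases hB : i ≤ m
      · have := key (i - (m - δ)) (by omega) (by omega)
        have e : m - δ + (i - (m - δ)) = i := by omega
        rw [if_pos (by omega), e] at this
        omega
      · rw [hνzero i (by omega)]
        by_cases hδm' : δ = m
        · rw [hρzero _ (by omega)]; omega
        · have := key (δ + 1) (by omega) (by omega)
          rw [if_neg (by omega), Nat.add_sub_cancel_left] at this
          have := hνbd
          have := hm (δ + 1) (i - (m - δ)) (by omega) (by omega)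
          omega

/-- Proposition (prop:rho-nu): writing `ν ⊕ d = (η_t^1, η_t^2)` with
`t = diag_0((ν⊕d)^{∨_r})` and `ρ = φ^r(ν)`, one has
`η_t^1 = ρ^{L^t} + ((r−t)^{m−t})` and `η_t^2 = ρ^{R^t}`, where `a = ρ′_t`,
`ρ^{L^t} = (t^{a−t}, ρ_{a+1}, …, ρ_m)` and `ρ^{R^t} = (ρ_1−t, …, ρ_a−t)`. -/
theorem stmt12 (m r n : ℕ) (hm : 0 < m) (hr : 0 < r) (hn : n = m + r)
    (ν : ℕ → ℕ)
    (hνmono : ∀ i, 1 ≤ i → ν (i + 1) ≤ ν i)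
    (hνzero : ∀ i, m < i → ν i = 0)
    (hνbd : ν 1 ≤ r)
    (d : ℕ) (hd : d ≤ diag0 n (complRect m r ν))
    (ρ : ℕ → ℕ)
    (hρmono : ∀ i, 1 ≤ i → ρ (i + 1) ≤ ρ i)
    (hρzero : ∀ i, m < i → ρ i = 0)
    (hρbd : ρ 1 ≤ r)
    (hcyc : ∀ p, 1 ≤ p → p ≤ n →
      (ZeroAt m ρ p ↔ ((p ≤ m ∧ ZeroAt m ν (p + r)) ∨ (m < p ∧ ZeroAt m ν (p - m)))))
    (μ : ℕ → ℕ) (hμ : OplusChain n r d ν μ) :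
    ∀ t a,
      t = diag0 n (complRect m r μ) →
      a = ((Finset.Icc 1 m).filter (fun i => t ≤ ρ i)).card →
      (∀ i, 1 ≤ i → i ≤ m - t →
        μ i = (if i ≤ a - t then t else ρ (i + t)) + (r - t)) ∧
      (∀ i, 1 ≤ i → μ (m - t + i) = if i ≤ a then ρ i - t else 0) := by
  subst hn
  intro t a ht ha
  have hmρ := mono_of_step ρ hρmono
  obtain ⟨hδm, hδr, hδρ, hbase⟩ := base m r ν ρ hνmono hνzero hνbd hρmono hρzero hρbd hcyc _ rfl
  set δ := diag0 (m + r) (complRect m r ν) with hδ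
  obtain ⟨f, f0, fd, hf⟩ := hμ
  have hind : ∀ k, k ≤ d → ∀ i, 1 ≤ i → f k i = Gfun m r ρ (δ - k) i := by
    intro k
    induction k with
    | zero => intro _; rw [f0]; exact hbase
    | succ k ih =>
      intro hk
      have hmono : ∀ i, 1 ≤ i → f k (i + 1) ≤ f k i := by
        rcases Nat.eq_zero_or_pos k with h | h
        · subst h; rw [f0]; exact hνmono
        · have := (hf (k - 1) (by omega)).1.1
          rwa [Nat.sub_add_cancel h] at this
      have e : δ - (k + 1) + 1 = δ - k := by omega
      have hρδ := hδρ (by omega)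
      refine step m r (δ - (k + 1)) ρ (f k) (f (k + 1)) (by omega) (by omega) hρmono hρzero hρbd
        ?_ ?_ hmono (hf k (by omega))
      · rw [e]
        have := hmρ (δ - k) δ (by omega) (by omega)
        omega
      · rw [e]; exact ih (by omega)
  have hG := hind d le_rfl
  rw [fd] at hG
  have hdiag := diag_eq m r (δ - d) ρ μ (by omega) (by omega) hρmono hρbd hG
  rw [hdiag] at ht
  rw [← ht] at hG
  have htm : t ≤ m := by omega
  have htr : t ≤ r := by omega
  obtain ⟨a1, a2⟩ := card_down (fun i => t ≤ ρ i) m (by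
    intro i j hi hij hj hP
    exact le_trans hP (hmρ i j hi hij))
  rw [← ha] at a1 a2
  constructor
  · intro i hi him
    rw [hG i hi, Gfun, if_pos him]
    have := a2 (i + t) (by omega) (by omega)
    split_ifs with h <;> omega
  · intro i hi
    rw [hG _ (by omega), Gfun, if_neg (by omega), Nat.add_sub_cancel_left]
    split_ifs with h
    · rfl
    · by_cases him : i ≤ m
      · have := a2 i hi him
        omega
      · rw [hρzero i (by omega)]; omega
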